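/- arXiv:1507.01154 — 2 statements merged into one kernel-verified Lean document; each statement's English description precedes it below -/
import Mathlib

section
/- Let L be an n×n real symmetric positive semidefinite matrix, B an n×m real matrix, and C an m×m real symmetric positive definite matrix such that the (n+m)×(n+m) block matrix [[L, B], [Bᵀ, C]] is positive semidefinite. Define Q = B C⁻¹ Bᵀ. Then (1/det(Q + I)) · exp(−tr(L − Q)) ≤ 1/det(L + I) ≤ 1/det(Q + I), where I is the n×n identity matrix. -/
open Matrix

namespace Matrix

variable {n : Type*} [Fintype n] [DecidableEq n]

theorem IsHermitian.det_one_add_eq_prod_eigenvalues {A : Matrix n n ℝ} (hA : A.IsHermitian) :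
    (1 + A).det = ∏ i, (1 + hA.eigenvalues i) := by
  have h := A.eval_charpoly (-1)
  rw [hA.charpoly_eq, Polynomial.eval_prod] at h
  have hneg : scalar n (-1 : ℝ) - A = -(1 + A) := by
    rw [map_neg, map_one]; abel
  have hprod : ∏ i, (-1 - hA.eigenvalues i) =
      (-1) ^ Fintype.card n * ∏ i, (1 + hA.eigenvalues i) := by
    rw [← Finset.card_univ, ← Finset.prod_const, ← Finset.prod_mul_distrib]
    exact Finset.prod_congr rfl fun i _ => by ring
  rw [hneg, det_neg] at h
  simp only [Polynomial.eval_sub, Polynomial.eval_X, Polynomial.eval_C, RCLike.ofReal_real_eq_id,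
    id_eq, hprod] at h
  exact (mul_left_cancel₀ (by simp) h).symm

theorem PosSemidef.one_le_det_one_add {A : Matrix n n ℝ} (hA : A.PosSemidef) :
    1 ≤ (1 + A).det := by
  rw [hA.1.det_one_add_eq_prod_eigenvalues]
  exact Finset.one_le_prod fun i _ => le_add_of_nonneg_right (hA.eigenvalues_nonneg i)

theorem PosSemidef.det_one_add_le_exp_trace {A : Matrix n n ℝ} (hA : A.PosSemidef) :
    (1 + A).det ≤ Real.exp A.trace := by
  rw [hA.1.det_one_add_eq_prod_eigenvalues, hA.1.trace_eq_sum_eigenvalues]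
  simp only [RCLike.ofReal_real_eq_id, id_eq]
  rw [Real.exp_sum]
  refine Finset.prod_le_prod (fun i _ => ?_) fun i _ => ?_
  · linarith [hA.eigenvalues_nonneg i]
  · linarith [Real.add_one_le_exp (hA.1.eigenvalues i)]

theorem PosSemidef.one_sub_inv_add_one {Q : Matrix n n ℝ} (hQ : Q.PosSemidef) :
    (1 - (Q + 1)⁻¹).PosSemidef := by
  have hP : (Q + 1).PosDef := PosDef.posSemidef_add hQ PosDef.one
  let := hP.isUnit.invertible
  let : Invertible (1 : Matrix n n ℝ) := invertibleOne
  have h₁ := PosDef.fromBlocks₁₁ (1 : Matrix n n ℝ) 1 hP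
  have h₂ := PosDef.fromBlocks₂₂ (Q + 1) (1 : Matrix n n ℝ) PosDef.one
  simp only [conjTranspose_one, one_mul, mul_one, inv_one, add_sub_cancel_right] at h₁ h₂
  exact h₁.1 (h₂.2 hQ)

/-- Adding a positive semidefinite `D` to `Q + 1` multiplies the determinant by a factor between
`1` and `exp (tr D)`. -/
theorem PosSemidef.det_add_one_add_bounds {Q D : Matrix n n ℝ} (hQ : Q.PosSemidef)
    (hD : D.PosSemidef) :
    (Q + 1).det ≤ (Q + 1 + D).det ∧
      (Q + 1 + D).det ≤ (Q + 1).det * Real.exp D.trace := by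
  have hP : (Q + 1).PosDef := PosDef.posSemidef_add hQ PosDef.one
  obtain ⟨S, rfl⟩ : ∃ S : Matrix n n ℝ, D = Sᴴ * S := by
    open scoped MatrixOrder in
    exact CStarAlgebra.nonneg_iff_eq_star_mul_self.1 (nonneg_iff_posSemidef.2 hD)
  have hX : (S * (Q + 1)⁻¹ * Sᴴ).PosSemidef := hP.inv.posSemidef.mul_mul_conjTranspose_same S
  have htrace : (S * (Q + 1)⁻¹ * Sᴴ).trace ≤ (Sᴴ * S).trace := by
    have h := (hQ.one_sub_inv_add_one.mul_mul_conjTranspose_same S).trace_nonneg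
    rw [mul_sub, sub_mul, trace_sub, mul_one, trace_mul_comm S Sᴴ] at h
    linarith
  rw [det_add_mul _ _ (hP.isUnit.map detMonoidHom)]
  refine ⟨le_mul_of_one_le_right hP.det_pos.le hX.one_le_det_one_add, ?_⟩
  exact mul_le_mul_of_nonneg_left
    (hX.det_one_add_le_exp_trace.trans (Real.exp_le_exp.2 htrace)) hP.det_pos.le

end Matrix

/-- Proposition 1 of the paper: nonspectral bounds on `1 / det(L + I)` via the
Nyström-type matrix `Q = B C⁻¹ Bᵀ` built from blocks of a positive semidefinite
block matrix `[[L, B], [Bᵀ, C]]`. -/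
theorem stmt_0 {n m : ℕ} (L : Matrix (Fin n) (Fin n) ℝ) (B : Matrix (Fin n) (Fin m) ℝ)
    (C : Matrix (Fin m) (Fin m) ℝ) (hL : L.PosSemidef) (hC : C.PosDef)
    (hblock : (Matrix.fromBlocks L B Bᵀ C).PosSemidef) :
    (1 / (B * C⁻¹ * Bᵀ + 1).det) * Real.exp (-(L - B * C⁻¹ * Bᵀ).trace)
        ≤ 1 / (L + 1).det ∧
      1 / (L + 1).det ≤ 1 / (B * C⁻¹ * Bᵀ + 1).det := by
  have hQ : (B * C⁻¹ * Bᵀ).PosSemidef := by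
    simpa using hC.inv.posSemidef.mul_mul_conjTranspose_same B
  have hD : (L - B * C⁻¹ * Bᵀ).PosSemidef := by
    let := hC.isUnit.invertible
    simpa using (PosDef.fromBlocks₂₂ L B hC).1 (by simpa using hblock)
  have hpos : 0 < (B * C⁻¹ * Bᵀ + 1).det := (PosDef.posSemidef_add hQ PosDef.one).det_pos
  obtain ⟨hlower, hupper⟩ := hQ.det_add_one_add_bounds hD
  rw [show B * C⁻¹ * Bᵀ + 1 + (L - B * C⁻¹ * Bᵀ) = L + 1 by abel] at hlower hupper
  refine ⟨?_, one_div_le_one_div_of_le hpos hlower⟩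
  rw [Real.exp_neg, ← div_eq_mul_inv, div_div]
  exact one_div_le_one_div_of_le (hpos.trans_le hlower) hupper
end

section
/- Fix D ≥ 1, positive reals σ₁, …, σ_D and ρ₁, …, ρ_D, reals μ₁, …, μ_D, and κ > 0. Define the kernel L(x, y) = exp(−Σ_{d=1}^D (x_d − y_d)²/(2σ_d²)) on ℝ^D × ℝ^D and the base density μ'(x) = κ ∏_{d=1}^D (2πρ_d²)^{−1/2} exp(−(x_d − μ_d)²/(2ρ_d²)). Then for any z_i, z_j ∈ ℝ^D, ∫_{ℝ^D} L(z_i, x) L(x, z_j) μ'(x) dx = κ ∏_{d=1}^D (2σ_d^{−2}ρ_d² + 1)^{−1/2} · exp(−(1/(4σ_d²))(z_{i,d} − z_{j,d})² − σ_d^{−2}(μ_d − z̄_d)²/(2σ_d^{−2}ρ_d² + 1)), where z̄_d = (z_{i,d} + z_{j,d})/2 and the integral is with respect to Lebesgue measure on ℝ^D. -/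
open Real MeasureTheory

/-- The product of two one-dimensional squared exponential kernels integrates against a
normalised Gaussian density to a closed form. -/
theorem integral_sqExp_mul_sqExp_mul_gaussian {s r : ℝ} (hs : 0 < s) (hr : 0 < r) (m z w : ℝ) :
    ∫ x : ℝ, Real.exp (-((z - x) ^ 2 / (2 * s ^ 2))) * Real.exp (-((x - w) ^ 2 / (2 * s ^ 2))) *
        ((2 * π * r ^ 2) ^ (-(1 : ℝ) / 2) * Real.exp (-(x - m) ^ 2 / (2 * r ^ 2)))
      = (2 * (s ^ 2)⁻¹ * r ^ 2 + 1) ^ (-(1 : ℝ) / 2) *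
          Real.exp (-(1 / (4 * s ^ 2)) * (z - w) ^ 2 -
            (s ^ 2)⁻¹ * (m - (z + w) / 2) ^ 2 / (2 * (s ^ 2)⁻¹ * r ^ 2 + 1)) := by
  have hq : 0 < 2 * (s ^ 2)⁻¹ * r ^ 2 + 1 := by positivity
  set q := 2 * (s ^ 2)⁻¹ * r ^ 2 + 1 with hq_def
  set e := -(1 / (4 * s ^ 2)) * (z - w) ^ 2 - (s ^ 2)⁻¹ * (m - (z + w) / 2) ^ 2 / q with he
  have complete_square : ∀ x : ℝ,
      Real.exp (-((z - x) ^ 2 / (2 * s ^ 2))) * Real.exp (-((x - w) ^ 2 / (2 * s ^ 2))) *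
        ((2 * π * r ^ 2) ^ (-(1 : ℝ) / 2) * Real.exp (-(x - m) ^ 2 / (2 * r ^ 2)))
      = (2 * π * r ^ 2) ^ (-(1 : ℝ) / 2) * Real.exp e *
        Real.exp (-(q / (2 * r ^ 2)) * (x - ((z + w) * r ^ 2 + m * s ^ 2) / (q * s ^ 2)) ^ 2) := by
    intro x
    have hexp : -((z - x) ^ 2 / (2 * s ^ 2)) + -((x - w) ^ 2 / (2 * s ^ 2)) +
          -(x - m) ^ 2 / (2 * r ^ 2)
        = e + -(q / (2 * r ^ 2)) * (x - ((z + w) * r ^ 2 + m * s ^ 2) / (q * s ^ 2)) ^ 2 := by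
      have hq' : q = (2 * r ^ 2 + s ^ 2) / s ^ 2 := by rw [hq_def]; field_simp
      have hpos : 2 * r ^ 2 + s ^ 2 ≠ 0 := by positivity
      rw [he, hq']
      field_simp
      ring
    have h := congrArg Real.exp hexp
    simp only [Real.exp_add] at h
    linear_combination (2 * π * r ^ 2) ^ (-(1 : ℝ) / 2) * h
  have normalization : (2 * π * r ^ 2) ^ (-(1 : ℝ) / 2) * √(π / (q / (2 * r ^ 2)))
      = q ^ (-(1 : ℝ) / 2) := by
    have hdiv : π / (q / (2 * r ^ 2)) = (2 * π * r ^ 2) / q := by field_simp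
    have hc : 0 < 2 * π * r ^ 2 := by positivity
    rw [hdiv, Real.sqrt_eq_rpow, Real.div_rpow hc.le hq.le, neg_div, Real.rpow_neg hc.le,
      Real.rpow_neg hq.le]
    have := (Real.rpow_pos_of_pos hc (1 / 2)).ne'
    field_simp
  simp_rw [complete_square]
  rw [integral_const_mul,
    integral_sub_right_eq_self (fun x : ℝ => Real.exp (-(q / (2 * r ^ 2)) * x ^ 2)),
    integral_gaussian, ← normalization]
  ring

/-- Appendix B of the paper: closed form of the entries
`Ψ_{ij} = ∫ L(z_i, x) L(x, z_j) dμ(x)` for the squared exponential kernel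
`L(x,y) = exp(−Σ_d (x_d−y_d)²/(2σ_d²))` with Gaussian base measure of density
`μ'(x) = κ ∏_d (2πρ_d²)^{-1/2} exp(−(x_d−μ_d)²/(2ρ_d²))`. -/
theorem stmt_14 {D : ℕ} (hD : 1 ≤ D) (σ ρ μ₀ : Fin D → ℝ)
    (hσ : ∀ d, 0 < σ d) (hρ : ∀ d, 0 < ρ d) (κ : ℝ) (hκ : 0 < κ)
    (zi zj : Fin D → ℝ) :
    (∫ x : Fin D → ℝ,
        Real.exp (-∑ d, (zi d - x d) ^ 2 / (2 * σ d ^ 2)) *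
          Real.exp (-∑ d, (x d - zj d) ^ 2 / (2 * σ d ^ 2)) *
          (κ * ∏ d, (2 * π * ρ d ^ 2) ^ (-(1 : ℝ) / 2) *
            Real.exp (-(x d - μ₀ d) ^ 2 / (2 * ρ d ^ 2))))
      = κ * ∏ d, (2 * (σ d ^ 2)⁻¹ * ρ d ^ 2 + 1) ^ (-(1 : ℝ) / 2) *
          Real.exp (-(1 / (4 * σ d ^ 2)) * (zi d - zj d) ^ 2 -
            (σ d ^ 2)⁻¹ * (μ₀ d - (zi d + zj d) / 2) ^ 2 /
              (2 * (σ d ^ 2)⁻¹ * ρ d ^ 2 + 1)) := by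
  have factor : ∀ x : Fin D → ℝ,
      Real.exp (-∑ d, (zi d - x d) ^ 2 / (2 * σ d ^ 2)) *
          Real.exp (-∑ d, (x d - zj d) ^ 2 / (2 * σ d ^ 2)) *
          (κ * ∏ d, (2 * π * ρ d ^ 2) ^ (-(1 : ℝ) / 2) *
            Real.exp (-(x d - μ₀ d) ^ 2 / (2 * ρ d ^ 2)))
        = κ * ∏ d, Real.exp (-((zi d - x d) ^ 2 / (2 * σ d ^ 2))) *
            Real.exp (-((x d - zj d) ^ 2 / (2 * σ d ^ 2))) *
            ((2 * π * ρ d ^ 2) ^ (-(1 : ℝ) / 2) *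
              Real.exp (-(x d - μ₀ d) ^ 2 / (2 * ρ d ^ 2))) := by
    intro x
    simp only [← Finset.sum_neg_distrib, Real.exp_sum, Finset.prod_mul_distrib]
    ring
  simp_rw [factor]
  rw [integral_const_mul, integral_fintype_prod_volume_eq_prod
    (fun d (t : ℝ) => Real.exp (-((zi d - t) ^ 2 / (2 * σ d ^ 2))) *
      Real.exp (-((t - zj d) ^ 2 / (2 * σ d ^ 2))) *
      ((2 * π * ρ d ^ 2) ^ (-(1 : ℝ) / 2) * Real.exp (-(t - μ₀ d) ^ 2 / (2 * ρ d ^ 2))))]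
  congr 1
  exact Finset.prod_congr rfl fun d _ =>
    integral_sqExp_mul_sqExp_mul_gaussian (hσ d) (hρ d) (μ₀ d) (zi d) (zj d)
end
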